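/- For q ∈ (0,1) and all n ≥ 3, P_n^q(S_n(312)) = P_n^q(S_n(231)) > P_n^q(S_n(213)) = P_n^q(S_n(132)). -/

import Mathlib

open Finset Filter Topology

noncomputable section

/-- Number of inversions of a permutation of `Fin n`. -/
def invCount {n : ℕ} (σ : Equiv.Perm (Fin n)) : ℕ :=
  (Finset.univ.filter (fun p : Fin n × Fin n => p.1 < p.2 ∧ σ p.2 < σ p.1)).card

/-- Mallows normalization constant `Z_n(q) = ∑_{σ ∈ S_n} q^{inv σ}`. -/
def mallowsZ (n : ℕ) (q : ℝ) : ℝ := ∑ σ : Equiv.Perm (Fin n), q ^ invCount σ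

/-- Mallows probability of a permutation. -/
def mallowsP (n : ℕ) (q : ℝ) (σ : Equiv.Perm (Fin n)) : ℝ := q ^ invCount σ / mallowsZ n q

/-- `σ` contains the pattern `τ`. -/
def ContainsPattern {n m : ℕ} (σ : Equiv.Perm (Fin n)) (τ : Equiv.Perm (Fin m)) : Prop :=
  ∃ f : Fin m → Fin n, StrictMono f ∧ ∀ j k : Fin m, τ j < τ k ↔ σ (f j) < σ (f k)

/-- `σ` avoids the pattern `τ`. -/
def AvoidsPattern {n m : ℕ} (σ : Equiv.Perm (Fin n)) (τ : Equiv.Perm (Fin m)) : Prop :=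
  ¬ ContainsPattern σ τ

open scoped Classical in
/-- Mallows probability that a permutation of `[n]` avoids the pattern `τ`,
i.e. `P_n^q(S_n(τ))`. -/
def avoidProb (n : ℕ) (q : ℝ) {m : ℕ} (τ : Equiv.Perm (Fin m)) : ℝ :=
  ∑ σ : Equiv.Perm (Fin n), if AvoidsPattern σ τ then mallowsP n q σ else 0

/-- The pattern 132 as a permutation of `Fin 3` (0-indexed values). -/
def p132 : Equiv.Perm (Fin 3) := ⟨![0,2,1], ![0,2,1], by decide, by decide⟩
/-- The pattern 213. -/
def p213 : Equiv.Perm (Fin 3) := ⟨![1,0,2], ![1,0,2], by decide, by decide⟩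
/-- The pattern 231. -/
def p231 : Equiv.Perm (Fin 3) := ⟨![1,2,0], ![2,0,1], by decide, by decide⟩
/-- The pattern 312. -/
def p312 : Equiv.Perm (Fin 3) := ⟨![2,0,1], ![1,2,0], by decide, by decide⟩
/-- The pattern 321. -/
def p321 : Equiv.Perm (Fin 3) := ⟨![2,1,0], ![2,1,0], by decide, by decide⟩

/-! ### Lists -/

/-- Inversions of a list. -/
def linv : List ℕ → ℕ
  | [] => 0
  | x :: xs => xs.countP (fun y => decide (y < x)) + linv xs

def lav231 : List ℕ → Prop
  | [] => True
  | x :: xs => xs.Pairwise (fun y z => ¬ (z < x ∧ x < y)) ∧ lav231 xs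

def lav132 : List ℕ → Prop
  | [] => True
  | x :: xs => xs.Pairwise (fun y z => ¬ (x < z ∧ z < y)) ∧ lav132 xs

lemma linv_ofFn {n : ℕ} (h : Fin n → ℕ) :
    linv (List.ofFn h) = ∑ i, ∑ j, if i < j ∧ h j < h i then 1 else 0 := by
  induction n with
  | zero => simp [linv]
  | succ n ih =>
    rw [List.ofFn_succ, linv, ih, Fin.sum_univ_succ]
    congr 1
    · rw [Fin.sum_univ_succ]
      simp only [lt_self_iff_false, false_and, if_false, zero_add, Fin.succ_pos, true_and]
      generalize h 0 = x
      generalize hg : (fun i : Fin n => h i.succ) = g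
      have : ∀ i, h (Fin.succ i) = g i := fun i => by rw [← hg]
      simp only [this]
      clear this hg ih h
      induction n with
      | zero => simp
      | succ n ih2 =>
        rw [List.ofFn_succ, List.countP_cons, ih2, Fin.sum_univ_succ, add_comm]
        simp
    · refine Finset.sum_congr rfl fun i _ => ?_
      rw [Fin.sum_univ_succ]
      simp

lemma linv_perm {n : ℕ} (σ : Equiv.Perm (Fin n)) :
    linv (List.ofFn (fun i => (σ i : ℕ))) = invCount σ := by
  rw [linv_ofFn, invCount, Finset.card_filter, ← Finset.univ_product_univ, Finset.sum_product]
  simp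

lemma lav231_ofFn {n : ℕ} (h : Fin n → ℕ) (H : lav231 (List.ofFn h)) :
    ∀ i j k, i < j → j < k → ¬ (h k < h i ∧ h i < h j) := by
  induction n with
  | zero => intro i; exact i.elim0
  | succ n ih =>
    rw [List.ofFn_succ, lav231, List.pairwise_ofFn] at H
    intro i j k hij hjk
    obtain ⟨j, rfl⟩ := Fin.exists_succ_eq.2 (Fin.ne_zero_of_lt hij)
    obtain ⟨k, rfl⟩ := Fin.exists_succ_eq.2 (Fin.ne_zero_of_lt hjk)
    rcases Fin.eq_zero_or_eq_succ i with rfl | ⟨i, rfl⟩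
    · exact H.1 (Fin.succ_lt_succ_iff.1 hjk)
    · exact ih _ H.2 i j k (Fin.succ_lt_succ_iff.1 hij) (Fin.succ_lt_succ_iff.1 hjk)

lemma ofFn_lav132 {n : ℕ} (h : Fin n → ℕ)
    (H : ∀ i j k, i < j → j < k → ¬ (h i < h k ∧ h k < h j)) : lav132 (List.ofFn h) := by
  induction n with
  | zero => simp [lav132]
  | succ n ih =>
    rw [List.ofFn_succ, lav132, List.pairwise_ofFn]
    refine ⟨fun j k hjk => H 0 j.succ k.succ (Fin.succ_pos _) (Fin.succ_lt_succ_iff.2 hjk), ?_⟩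
    exact ih _ fun i j k hij hjk =>
      H _ _ _ (Fin.succ_lt_succ_iff.2 hij) (Fin.succ_lt_succ_iff.2 hjk)

lemma countP_all (L : List ℕ) (x : ℕ) (h : ∀ y ∈ L, y < x) :
    L.countP (fun y => decide (y < x)) = L.length := by
  rw [List.countP_eq_length]; simpa using h

lemma countP_none (L : List ℕ) (x : ℕ) (h : ∀ y ∈ L, x < y) :
    L.countP (fun y => decide (y < x)) = 0 := by
  rw [List.countP_eq_zero]; intro y hy; have := h y hy; simp; omega

lemma linv_append_lt (L R : List ℕ) (m : ℕ) (hL : ∀ x ∈ L, x < m) (hR : ∀ x ∈ R, x < m)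
    (hLR : ∀ x ∈ L, ∀ y ∈ R, x < y) : linv (L ++ m :: R) = linv L + linv R + R.length := by
  induction L with
  | nil => simp [linv, countP_all R m hR]; omega
  | cons x L ih =>
    simp only [List.mem_cons, forall_eq_or_imp] at hL hLR
    have h1 := ih hL.2 hLR.2
    simp only [List.cons_append, linv, List.countP_append, List.countP_cons,
      countP_none R x hLR.1, h1]
    have := hL.1
    have h2 : ¬ m < x := by omega
    simp [h2]; omega

lemma linv_append_gt (L R : List ℕ) (m : ℕ) (hL : ∀ x ∈ L, x < m) (hR : ∀ x ∈ R, x < m)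
    (hLR : ∀ x ∈ L, ∀ y ∈ R, y < x) :
    linv (L ++ m :: R) = linv L + linv R + R.length * (L.length + 1) := by
  induction L with
  | nil => simp [linv, countP_all R m hR]; omega
  | cons x L ih =>
    simp only [List.mem_cons, forall_eq_or_imp] at hL hLR
    have h1 := ih hL.2 hLR.2
    simp only [List.cons_append, linv, List.countP_append, List.countP_cons,
      countP_all R x hLR.1, h1, List.length_cons]
    have := hL.1
    have h2 : ¬ m < x := by omega
    simp [h2]; ring

lemma lav231_append (L R : List ℕ) (m : ℕ) (hL : ∀ x ∈ L, x < m) (hR : ∀ x ∈ R, x < m)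
    (hLR : ∀ x ∈ L, ∀ y ∈ R, x < y) (aL : lav231 L) (aR : lav231 R) :
    lav231 (L ++ m :: R) := by
  induction L with
  | nil =>
    refine ⟨?_, aR⟩
    refine List.pairwise_iff_forall_sublist.2 fun {y z} hyz => ?_
    have := hR y (hyz.subset (by simp)); omega
  | cons x L ih =>
    simp only [List.mem_cons, forall_eq_or_imp] at hL hLR
    refine ⟨?_, ih hL.2 hLR.2 aL.2⟩
    refine List.pairwise_append.2 ?_
    rw [List.pairwise_cons]
    refine ⟨aL.1, ⟨?_, ?_⟩, ?_⟩
    · intro z hz; have := hLR.1 z hz; omega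
    · refine List.pairwise_iff_forall_sublist.2 fun {y z} hyz => ?_
      have := hLR.1 z (hyz.subset (by simp)); omega
    · intro y hy z hz
      rcases List.mem_cons.1 hz with rfl | hz
      · have := hL.1; omega
      · have := hLR.1 z hz; omega

lemma lav132_append (L R : List ℕ) (m : ℕ) (hR : ∀ x ∈ R, x < m)
    (H : lav132 (L ++ m :: R)) :
    lav132 L ∧ lav132 R ∧ ∀ x ∈ L, ∀ y ∈ R, ¬ x < y := by
  induction L with
  | nil => exact ⟨trivial, H.2, by simp⟩
  | cons x L ih =>
    obtain ⟨h1, h2⟩ := H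
    obtain ⟨a, b, c⟩ := ih h2
    replace h1 := List.pairwise_append.1 h1
    rw [List.pairwise_cons] at h1
    refine ⟨⟨h1.1, a⟩, b, ?_⟩
    intro x' hx' y hy
    rcases List.mem_cons.1 hx' with rfl | hx'
    · have := h1.2.1.1 y hy
      have := hR y hy
      omega
    · exact c x' hx' y hy

open BinaryTree in
/-- 231-avoiding list of a tree, with values `a, a+1, …`. -/
def lf : BinaryTree Unit → ℕ → List ℕ
  | nil, _ => []
  | node _ l r, a => lf l a ++ (a + l.numNodes + r.numNodes) :: lf r (a + l.numNodes)

open BinaryTree in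
/-- 132-avoiding list of a tree, with values `a, a+1, …`. -/
def lg : BinaryTree Unit → ℕ → List ℕ
  | nil, _ => []
  | node _ l r, a => lg l (a + r.numNodes) ++ (a + l.numNodes + r.numNodes) :: lg r a

open BinaryTree in
def wf : BinaryTree Unit → ℕ
  | nil => 0
  | node _ l r => wf l + wf r + r.numNodes

open BinaryTree in
def wg : BinaryTree Unit → ℕ
  | nil => 0
  | node _ l r => wg l + wg r + r.numNodes * (l.numNodes + 1)

lemma wf_le_wg (t : BinaryTree Unit) : wf t ≤ wg t := by
  induction t with
  | nil => simp [wf, wg]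
  | node _ l r h1 h2 => simp only [wf, wg]; nlinarith [Nat.zero_le (r.numNodes * l.numNodes)]

lemma lf_perm (t : BinaryTree Unit) (a : ℕ) : (lf t a).Perm (List.range' a t.numNodes) := by
  induction t generalizing a with
  | nil => simp [lf, BinaryTree.numNodes]
  | node _ l r h1 h2 =>
    simp only [lf, BinaryTree.numNodes]
    refine List.perm_middle.trans ?_
    rw [List.range'_concat, ← List.range'_append_1]
    refine List.Perm.trans ?_ (List.perm_append_singleton _ _).symm
    rw [one_mul, ← add_assoc]
    exact List.Perm.cons _ ((h1 a).append (h2 _))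

lemma lg_perm (t : BinaryTree Unit) (a : ℕ) : (lg t a).Perm (List.range' a t.numNodes) := by
  induction t generalizing a with
  | nil => simp [lg, BinaryTree.numNodes]
  | node _ l r h1 h2 =>
    simp only [lg, BinaryTree.numNodes]
    refine List.perm_middle.trans ?_
    rw [List.range'_concat, add_comm l.numNodes r.numNodes, ← List.range'_append_1]
    refine List.Perm.trans ?_ (List.perm_append_singleton _ _).symm
    rw [one_mul, add_assoc a, add_comm l.numNodes r.numNodes]
    exact List.Perm.cons _ (List.perm_append_comm.trans ((h2 a).append (h1 _)))

lemma lf_mem (t : BinaryTree Unit) (a x : ℕ) (h : x ∈ lf t a) : a ≤ x ∧ x < a + t.numNodes := by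
  have := (lf_perm t a).subset h
  simpa [List.mem_range'_1] using this

lemma lg_mem (t : BinaryTree Unit) (a x : ℕ) (h : x ∈ lg t a) : a ≤ x ∧ x < a + t.numNodes := by
  have := (lg_perm t a).subset h
  simpa [List.mem_range'_1] using this

lemma lf_length (t : BinaryTree Unit) (a : ℕ) : (lf t a).length = t.numNodes := by
  simpa using (lf_perm t a).length_eq

lemma lg_length (t : BinaryTree Unit) (a : ℕ) : (lg t a).length = t.numNodes := by
  simpa using (lg_perm t a).length_eq

lemma lf_linv (t : BinaryTree Unit) (a : ℕ) : linv (lf t a) = wf t ∧ lav231 (lf t a) := by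
  induction t generalizing a with
  | nil => simp [lf, wf, linv, lav231]
  | node _ l r h1 h2 =>
    have e1 : ∀ x ∈ lf l a, x < a + l.numNodes + r.numNodes := by
      intro x hx; have := lf_mem _ _ _ hx; omega
    have e2 : ∀ x ∈ lf r (a + l.numNodes), x < a + l.numNodes + r.numNodes := by
      intro x hx; have := lf_mem _ _ _ hx; omega
    have e3 : ∀ x ∈ lf l a, ∀ y ∈ lf r (a + l.numNodes), x < y := by
      intro x hx y hy; have := lf_mem _ _ _ hx; have := lf_mem _ _ _ hy; omega
    refine ⟨?_, lav231_append _ _ _ e1 e2 e3 (h1 _).2 (h2 _).2⟩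
    simp only [lf, wf]
    rw [linv_append_lt _ _ _ e1 e2 e3, (h1 _).1, (h2 _).1, lf_length]

lemma lg_linv (t : BinaryTree Unit) (a : ℕ) : linv (lg t a) = wg t := by
  induction t generalizing a with
  | nil => simp [lg, wg, linv]
  | node _ l r h1 h2 =>
    simp only [lg, wg]
    rw [linv_append_gt, h1, h2, lg_length, lg_length]
    · intro x hx; have := lg_mem _ _ _ hx; omega
    · intro x hx; have := lg_mem _ _ _ hx; omega
    · intro x hx y hy; have := lg_mem _ _ _ hx; have := lg_mem _ _ _ hy; omega

lemma split_unique (L R L' R' : List ℕ) (m : ℕ) (h1 : m ∉ L) (h2 : m ∉ L')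
    (h : L ++ m :: R = L' ++ m :: R') : L = L' ∧ R = R' := by
  induction L generalizing L' with
  | nil =>
    cases L' with
    | nil => simpa using h
    | cons y L' => simp at h h2; exact absurd h.1 h2.1
  | cons x L ih =>
    cases L' with
    | nil => simp at h h1; exact absurd h.1.symm h1.1
    | cons y L' =>
      simp only [List.mem_cons, not_or, List.cons_append, List.cons.injEq] at h h1 h2
      obtain ⟨a, b⟩ := ih L' h1.2 h2.2 h.2
      exact ⟨by rw [h.1, a], b⟩

lemma lf_inj (t s : BinaryTree Unit) (a : ℕ) (h : lf t a = lf s a) : t = s := by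
  induction t generalizing s a with
  | nil =>
    cases s with
    | nil => rfl
    | node _ l r => simp [lf] at h
  | node _ l r h1 h2 =>
    cases s with
    | nil => simp [lf] at h
    | node _ l' r' =>
      have hlen := congrArg List.length h
      rw [lf_length, lf_length] at hlen
      simp only [BinaryTree.numNodes] at hlen
      simp only [lf] at h
      have hm : a + l'.numNodes + r'.numNodes = a + l.numNodes + r.numNodes := by omega
      rw [hm] at h
      obtain ⟨e1, e2⟩ := split_unique _ _ _ _ _
        (fun hx => by have := lf_mem _ _ _ hx; omega)
        (fun hx => by have := lf_mem _ _ _ hx; omega) h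
      obtain rfl := h1 _ _ e1
      obtain rfl := h2 _ _ e2
      rfl

lemma perm_split (L R : List ℕ) (a n : ℕ) (h : (R ++ L).Perm (List.range' a n))
    (hLR : ∀ x ∈ L, ∀ y ∈ R, y < x) :
    R.Perm (List.range' a R.length) ∧ L.Perm (List.range' (a + R.length) L.length) := by
  have hn : n = R.length + L.length := by simpa using h.length_eq.symm
  subst hn
  have p1 := List.mergeSort_perm R (fun a b => decide (a ≤ b))
  have p2 := List.mergeSort_perm L (fun a b => decide (a ≤ b))
  have s1 : (R.mergeSort (fun a b => decide (a ≤ b))).Pairwise (· ≤ ·) := by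
    simpa using List.pairwise_mergeSort (le := fun a b : ℕ => decide (a ≤ b))
      (by intro a b c; simp; omega) (by intro a b; simp; omega) R
  have s2 : (L.mergeSort (fun a b => decide (a ≤ b))).Pairwise (· ≤ ·) := by
    simpa using List.pairwise_mergeSort (le := fun a b : ℕ => decide (a ≤ b))
      (by intro a b c; simp; omega) (by intro a b; simp; omega) L
  rw [← List.range'_append_1] at h
  have key := List.Perm.eq_of_pairwise' (r := (· ≤ ·))
    (List.pairwise_append.2 ⟨s1, s2, fun x hx y hy =>
      (hLR y (p2.subset hy) x (p1.subset hx)).le⟩)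
    (by
      rw [List.range'_append_1]
      exact (List.pairwise_lt_range').imp (fun h => le_of_lt h)) ((p1.append p2).trans h)
  obtain ⟨k1, k2⟩ := List.append_inj key (by simp)
  rw [k1] at p1
  rw [k2] at p2
  exact ⟨p1.symm, p2.symm⟩

lemma lg_surj (n : ℕ) : ∀ (a : ℕ) (l : List ℕ), l.Perm (List.range' a n) → lav132 l →
    ∃ t : BinaryTree Unit, t.numNodes = n ∧ lg t a = l := by
  induction n using Nat.strong_induction_on with
  | _ n ih =>
    intro a l hp hav
    cases n with
    | zero => exact ⟨.nil, rfl, by simpa [lg, eq_comm] using hp⟩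
    | succ n =>
      have hm : a + n ∈ l := by
        rw [hp.mem_iff]; simp [List.mem_range'_1]
      obtain ⟨L, R, rfl⟩ := List.append_of_mem hm
      have hp2 : (L ++ R).Perm (List.range' a n) := by
        have h3 := List.perm_middle.symm.trans hp
        rw [List.range'_concat, one_mul] at h3
        exact (h3.trans (List.perm_append_singleton _ _)).cons_inv
      have hlt : ∀ x ∈ L ++ R, x < a + n := by
        intro x hx
        have := hp2.subset hx
        rw [List.mem_range'_1] at this; omega
      obtain ⟨aL, aR, hLR⟩ := lav132_append L R (a + n)
        (fun x hx => hlt x (List.mem_append_right _ hx)) hav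
      have hnd : (L ++ R).Nodup := hp2.nodup_iff.2 List.nodup_range'
      have hdis := (List.nodup_append.1 hnd).2.2
      have hgt : ∀ x ∈ L, ∀ y ∈ R, y < x := by
        intro x hx y hy
        have := hLR x hx y hy
        have := hdis x hx y hy
        omega
      obtain ⟨q1, q2⟩ := perm_split L R a n (List.perm_append_comm.trans hp2) hgt
      have hlen : L.length + R.length = n := by simpa using hp2.length_eq
      obtain ⟨tr, r1, r2⟩ := ih R.length (by omega) a R q1 aR
      obtain ⟨tl, l1, l2⟩ := ih L.length (by omega) _ L q2 aL
      refine ⟨.node () tl tr, ?_, ?_⟩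
      · simp only [BinaryTree.numNodes]; omega
      · simp only [lg, r1, l1, r2, l2, add_assoc, hlen]

/-! ### Patterns -/

lemma contains_iff {n : ℕ} (σ : Equiv.Perm (Fin n)) (τ : Equiv.Perm (Fin 3)) :
    ContainsPattern σ τ ↔ ∃ i j k, i < j ∧ j < k ∧ (τ 0 < τ 1 ↔ σ i < σ j) ∧
      (τ 0 < τ 2 ↔ σ i < σ k) ∧ (τ 1 < τ 2 ↔ σ j < σ k) := by
  constructor
  · rintro ⟨f, hf, h⟩
    exact ⟨f 0, f 1, f 2, hf (by decide), hf (by decide), h _ _, h _ _, h _ _⟩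
  · rintro ⟨i, j, k, hij, hjk, h1, h2, h3⟩
    have flip : ∀ (a b : Fin 3) (x y : Fin n), a ≠ b → x ≠ y →
        (τ a < τ b ↔ σ x < σ y) → (τ b < τ a ↔ σ y < σ x) := by
      intro a b x y hab hxy hh
      have e1 : τ a ≠ τ b := fun e => hab (τ.injective e)
      have e2 : σ x ≠ σ y := fun e => hxy (σ.injective e)
      constructor
      · intro h4
        exact lt_of_le_of_ne (not_lt.1 fun h5 => absurd (hh.2 h5) h4.asymm) e2.symm
      · intro h4
        exact lt_of_le_of_ne (not_lt.1 fun h5 => absurd (hh.1 h5) h4.asymm) e1.symm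
    refine ⟨![i, j, k], ?_, ?_⟩
    · intro a b hab
      fin_cases a <;> fin_cases b <;> first | exact absurd hab (by decide) | skip
      · exact hij
      · exact hij.trans hjk
      · exact hjk
    · have h4 := flip 0 1 i j (by decide) hij.ne h1
      have h5 := flip 0 2 i k (by decide) (hij.trans hjk).ne h2
      have h6 := flip 1 2 j k (by decide) hjk.ne h3
      intro a b
      fin_cases a <;> fin_cases b <;> first | exact h1 | exact h2 | exact h3 | exact h4 | exact h5 | exact h6 | simp

lemma contains231 {n : ℕ} (σ : Equiv.Perm (Fin n)) :
    ContainsPattern σ p231 ↔ ∃ i j k, i < j ∧ j < k ∧ σ k < σ i ∧ σ i < σ j := by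
  rw [contains_iff]
  have e1 : p231 0 < p231 1 := by decide
  have e2 : ¬ p231 0 < p231 2 := by decide
  have e3 : ¬ p231 1 < p231 2 := by decide
  simp only [e1, e2, e3, true_iff, false_iff, not_lt]
  refine exists_congr fun i => exists_congr fun j => exists_congr fun k => ?_
  constructor
  · rintro ⟨a, b, c, d, e⟩
    exact ⟨a, b, lt_of_le_of_ne d fun h => (a.trans b).ne (σ.injective h).symm, c⟩
  · rintro ⟨a, b, c, d⟩
    exact ⟨a, b, d, c.le, (c.trans d).le⟩

lemma contains312 {n : ℕ} (σ : Equiv.Perm (Fin n)) :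
    ContainsPattern σ p312 ↔ ∃ i j k, i < j ∧ j < k ∧ σ j < σ k ∧ σ k < σ i := by
  rw [contains_iff]
  have e1 : ¬ p312 0 < p312 1 := by decide
  have e2 : ¬ p312 0 < p312 2 := by decide
  have e3 : p312 1 < p312 2 := by decide
  simp only [e1, e2, e3, true_iff, false_iff, not_lt]
  refine exists_congr fun i => exists_congr fun j => exists_congr fun k => ?_
  constructor
  · rintro ⟨a, b, c, d, e⟩
    exact ⟨a, b, e, lt_of_le_of_ne d fun h => (a.trans b).ne (σ.injective h).symm⟩
  · rintro ⟨a, b, c, d⟩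
    exact ⟨a, b, (c.trans d).le, d.le, c⟩

lemma contains132 {n : ℕ} (σ : Equiv.Perm (Fin n)) :
    ContainsPattern σ p132 ↔ ∃ i j k, i < j ∧ j < k ∧ σ i < σ k ∧ σ k < σ j := by
  rw [contains_iff]
  have e1 : p132 0 < p132 1 := by decide
  have e2 : p132 0 < p132 2 := by decide
  have e3 : ¬ p132 1 < p132 2 := by decide
  simp only [e1, e2, e3, true_iff, false_iff, not_lt]
  refine exists_congr fun i => exists_congr fun j => exists_congr fun k => ?_
  constructor
  · rintro ⟨a, b, c, d, e⟩
    exact ⟨a, b, d, lt_of_le_of_ne e fun h => b.ne (σ.injective h).symm⟩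
  · rintro ⟨a, b, c, d⟩
    exact ⟨a, b, c.trans d, c, d.le⟩

lemma contains213 {n : ℕ} (σ : Equiv.Perm (Fin n)) :
    ContainsPattern σ p213 ↔ ∃ i j k, i < j ∧ j < k ∧ σ j < σ i ∧ σ i < σ k := by
  rw [contains_iff]
  have e1 : ¬ p213 0 < p213 1 := by decide
  have e2 : p213 0 < p213 2 := by decide
  have e3 : p213 1 < p213 2 := by decide
  simp only [e1, e2, e3, true_iff, false_iff, not_lt]
  refine exists_congr fun i => exists_congr fun j => exists_congr fun k => ?_
  constructor
  · rintro ⟨a, b, c, d, e⟩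
    exact ⟨a, b, lt_of_le_of_ne c fun h => a.ne (σ.injective h).symm, d⟩
  · rintro ⟨a, b, c, d⟩
    exact ⟨a, b, c.le, d, c.trans d⟩

/-! ### Symmetries -/

lemma invCount_inv {n : ℕ} (σ : Equiv.Perm (Fin n)) : invCount σ⁻¹ = invCount σ := by
  unfold invCount
  refine Finset.card_bij' (fun p _ => (σ⁻¹ p.2, σ⁻¹ p.1)) (fun p _ => (σ p.2, σ p.1)) ?_ ?_ ?_ ?_
  · intro p hp; simp at hp ⊢; exact ⟨hp.2, hp.1⟩
  · intro p hp; simp at hp ⊢; exact ⟨hp.2, hp.1⟩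
  · intro p hp; simp
  · intro p hp; simp

lemma contains_inv {n : ℕ} (σ : Equiv.Perm (Fin n)) :
    ContainsPattern σ⁻¹ p312 ↔ ContainsPattern σ p231 := by
  rw [contains312, contains231]
  constructor
  · rintro ⟨i, j, k, h1, h2, h3, h4⟩
    exact ⟨σ⁻¹ j, σ⁻¹ k, σ⁻¹ i, h3, h4, by simpa using h1, by simpa using h2⟩
  · rintro ⟨i, j, k, h1, h2, h3, h4⟩
    exact ⟨σ k, σ i, σ j, h3, h4, by simpa using h1, by simpa using h2⟩

/-- Reverse-complement. -/
def rc {n : ℕ} : Equiv.Perm (Fin n) ≃ Equiv.Perm (Fin n) := Equiv.permCongr Fin.revPerm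

lemma rc_apply {n : ℕ} (σ : Equiv.Perm (Fin n)) (i : Fin n) : rc σ i = (σ i.rev).rev := by
  simp [rc]

lemma invCount_rc {n : ℕ} (σ : Equiv.Perm (Fin n)) : invCount (rc σ) = invCount σ := by
  unfold invCount
  refine Finset.card_bij' (fun p _ => (p.2.rev, p.1.rev)) (fun p _ => (p.2.rev, p.1.rev)) ?_ ?_ ?_ ?_
  · intro p hp; simp [rc_apply] at hp ⊢; exact hp
  · intro p hp; simp [rc_apply] at hp ⊢; exact hp
  · intro p hp; simp
  · intro p hp; simp

lemma contains_rc {n : ℕ} (σ : Equiv.Perm (Fin n)) :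
    ContainsPattern (rc σ) p213 ↔ ContainsPattern σ p132 := by
  rw [contains213, contains132]
  simp only [rc_apply, Fin.rev_lt_rev]
  constructor
  · rintro ⟨i, j, k, h1, h2, h3, h4⟩
    exact ⟨k.rev, j.rev, i.rev, by simpa using h2, by simpa using h1, h4, h3⟩
  · rintro ⟨i, j, k, h1, h2, h3, h4⟩
    exact ⟨k.rev, j.rev, i.rev, by simpa using h2, by simpa using h1, by simpa using h4,
      by simpa using h3⟩

open scoped Classical in
lemma avoidProb_congr {n m : ℕ} (q : ℝ) (τ τ' : Equiv.Perm (Fin m))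
    (e : Equiv.Perm (Fin n) ≃ Equiv.Perm (Fin n)) (h1 : ∀ σ, invCount (e σ) = invCount σ)
    (h2 : ∀ σ, ContainsPattern (e σ) τ ↔ ContainsPattern σ τ') :
    avoidProb n q τ = avoidProb n q τ' := by
  unfold avoidProb
  rw [← e.sum_comp]
  refine Finset.sum_congr rfl fun σ _ => ?_
  have h3 : AvoidsPattern (e σ) τ ↔ AvoidsPattern σ τ' := not_congr (h2 σ)
  have h4 : mallowsP n q (e σ) = mallowsP n q σ := by rw [mallowsP, mallowsP, h1]
  rw [h4]
  exact if_congr h3 rfl rfl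

open scoped Classical in
lemma avoidProb_eq (n m : ℕ) (q : ℝ) (τ : Equiv.Perm (Fin m)) :
    avoidProb n q τ =
      (∑ σ ∈ Finset.univ.filter (fun σ : Equiv.Perm (Fin n) => AvoidsPattern σ τ),
        q ^ invCount σ) / mallowsZ n q := by
  unfold avoidProb mallowsP
  rw [← Finset.sum_filter, Finset.sum_div]

/-! ### Trees to permutations -/

lemma exists_perm (n : ℕ) (l : List ℕ) (h : l.Perm (List.range' 0 n)) :
    ∃ σ : Equiv.Perm (Fin n), List.ofFn (fun i => (σ i : ℕ)) = l := by
  have hl : l.length = n := by simpa using h.length_eq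
  subst hl
  have hnd : l.Nodup := h.nodup_iff.2 List.nodup_range'
  have hlt : ∀ i : Fin l.length, l.get i < l.length := by
    intro i
    have := h.subset (l.get_mem i)
    rw [List.mem_range'_1] at this; omega
  let f : Fin l.length → Fin l.length := fun i => ⟨l.get i, hlt i⟩
  have hf : Function.Injective f := by
    intro i j hij
    have : l.get i = l.get j := congrArg Fin.val hij
    exact (List.nodup_iff_injective_get.1 hnd) this
  refine ⟨Equiv.ofBijective f (Finite.injective_iff_bijective.1 hf), ?_⟩
  simp [f]

lemma ofFn_perm_perm {n : ℕ} (σ : Equiv.Perm (Fin n)) :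
    (List.ofFn (fun i => (σ i : ℕ))).Perm (List.range' 0 n) := by
  refine (List.perm_ext_iff_of_nodup ?_ List.nodup_range').2 ?_
  · rw [List.nodup_ofFn]
    intro i j h
    exact σ.injective (Fin.ext h)
  · intro x
    rw [List.mem_range'_1, List.mem_ofFn]
    constructor
    · rintro ⟨i, rfl⟩; simp
    · intro hx
      exact ⟨σ⁻¹ ⟨x, by omega⟩, by simp⟩

open scoped Classical in
lemma sum231_ge (n : ℕ) (q : ℝ) (hq : 0 < q) :
    ∑ t ∈ BinaryTree.treesOfNumNodesEq n, q ^ wf t ≤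
      ∑ σ ∈ Finset.univ.filter (fun σ : Equiv.Perm (Fin n) => AvoidsPattern σ p231),
        q ^ invCount σ := by
  have H : ∀ t : BinaryTree Unit, ∃ σ : Equiv.Perm (Fin n),
      t ∈ BinaryTree.treesOfNumNodesEq n → List.ofFn (fun i => (σ i : ℕ)) = lf t 0 := by
    intro t
    by_cases ht : t ∈ BinaryTree.treesOfNumNodesEq n
    · obtain ⟨σ, hσ⟩ := exists_perm n (lf t 0) (by
        have := lf_perm t 0
        rwa [BinaryTree.mem_treesOfNumNodesEq.1 ht] at this)
      exact ⟨σ, fun _ => hσ⟩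
    · exact ⟨1, fun h => absurd h ht⟩
  choose F hF using H
  have e : ∑ t ∈ BinaryTree.treesOfNumNodesEq n, q ^ wf t =
      ∑ σ ∈ (BinaryTree.treesOfNumNodesEq n).image F, q ^ invCount σ := by
    rw [Finset.sum_image]
    · refine Finset.sum_congr rfl fun t ht => ?_
      rw [← linv_perm, hF t ht, (lf_linv t 0).1]
    · intro t ht s hs hts
      refine lf_inj t s 0 ?_
      rw [← hF t ht, ← hF s hs, hts]
  rw [e]
  refine Finset.sum_le_sum_of_subset_of_nonneg ?_ fun σ _ _ => by positivity
  intro σ hσ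
  obtain ⟨t, ht, rfl⟩ := Finset.mem_image.1 hσ
  refine Finset.mem_filter.2 ⟨Finset.mem_univ _, ?_⟩
  rw [AvoidsPattern, contains231]
  rintro ⟨i, j, k, h1, h2, h3, h4⟩
  refine lav231_ofFn (fun i => (F t i : ℕ)) ?_ i j k h1 h2 ⟨h3, h4⟩
  rw [hF t ht]
  exact (lf_linv t 0).2

open scoped Classical in
lemma sum132_le (n : ℕ) (q : ℝ) (hq : 0 < q) :
    ∑ σ ∈ Finset.univ.filter (fun σ : Equiv.Perm (Fin n) => AvoidsPattern σ p132),
        q ^ invCount σ ≤ ∑ t ∈ BinaryTree.treesOfNumNodesEq n, q ^ wg t := by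
  have H : ∀ σ : Equiv.Perm (Fin n), ∃ t : BinaryTree Unit, AvoidsPattern σ p132 →
      t.numNodes = n ∧ lg t 0 = List.ofFn (fun i => (σ i : ℕ)) := by
    intro σ
    by_cases h : AvoidsPattern σ p132
    · obtain ⟨t, ht⟩ := lg_surj n 0 _ (ofFn_perm_perm σ) (ofFn_lav132 _ (by
        intro i j k h1 h2 h3
        exact h ((contains132 σ).2 ⟨i, j, k, h1, h2, h3.1, h3.2⟩)))
      exact ⟨t, fun _ => ht⟩
    · exact ⟨.nil, fun h' => absurd h' h⟩
  choose G hG using H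
  have e : ∑ σ ∈ Finset.univ.filter (fun σ : Equiv.Perm (Fin n) => AvoidsPattern σ p132),
        q ^ invCount σ =
      ∑ t ∈ (Finset.univ.filter (fun σ : Equiv.Perm (Fin n) => AvoidsPattern σ p132)).image G,
        q ^ wg t := by
    rw [Finset.sum_image]
    · refine Finset.sum_congr rfl fun σ hσ => ?_
      rw [← linv_perm, ← (hG σ (Finset.mem_filter.1 hσ).2).2, lg_linv]
    · intro σ hσ ρ hρ h
      have h1 := (hG σ (Finset.mem_filter.1 hσ).2).2
      have h2 := (hG ρ (Finset.mem_filter.1 hρ).2).2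
      rw [h, h2] at h1
      have h3 := List.ofFn_injective h1
      ext i
      exact (congrFun h3 i).symm
  rw [e]
  refine Finset.sum_le_sum_of_subset_of_nonneg ?_ fun σ _ _ => by positivity
  intro t ht
  obtain ⟨σ, hσ, rfl⟩ := Finset.mem_image.1 ht
  exact BinaryTree.mem_treesOfNumNodesEq.2 (hG σ (Finset.mem_filter.1 hσ).2).1

lemma exists_tree (n : ℕ) : ∃ t : BinaryTree Unit, t.numNodes = n := by
  induction n with
  | zero => exact ⟨.nil, rfl⟩
  | succ n ih =>
    obtain ⟨t, ht⟩ := ih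
    exact ⟨.node () t .nil, by simp [BinaryTree.numNodes, ht]⟩

lemma trees_lt (n : ℕ) (hn : 3 ≤ n) (q : ℝ) (hq : q ∈ Set.Ioo (0:ℝ) 1) :
    ∑ t ∈ BinaryTree.treesOfNumNodesEq n, q ^ wg t <
      ∑ t ∈ BinaryTree.treesOfNumNodesEq n, q ^ wf t := by
  refine Finset.sum_lt_sum
    (fun t _ => pow_le_pow_of_le_one hq.1.le hq.2.le (wf_le_wg t)) ?_
  obtain ⟨r, hr⟩ := exists_tree (n - 2)
  refine ⟨.node () (.node () .nil .nil) r, ?_, pow_lt_pow_right_of_lt_one₀ hq.1 hq.2 ?_⟩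
  · rw [BinaryTree.mem_treesOfNumNodesEq]
    simp only [BinaryTree.numNodes, hr]; omega
  · have := wf_le_wg r
    simp only [wf, wg, BinaryTree.numNodes, hr]
    omega

/-- `P_n^q(S_n(312)) = P_n^q(S_n(231)) > P_n^q(S_n(213)) = P_n^q(S_n(132))` for `n ≥ 3`. -/
theorem stmt8 (q : ℝ) (hq : q ∈ Set.Ioo (0:ℝ) 1) (n : ℕ) (hn : 3 ≤ n) :
    avoidProb n q p312 = avoidProb n q p231 ∧
    avoidProb n q p231 > avoidProb n q p213 ∧
    avoidProb n q p213 = avoidProb n q p132 := by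
  have h1 : avoidProb n q p312 = avoidProb n q p231 :=
    avoidProb_congr q p312 p231 (Equiv.inv _) (fun σ => invCount_inv σ) (fun σ => contains_inv σ)
  have h2 : avoidProb n q p213 = avoidProb n q p132 :=
    avoidProb_congr q p213 p132 rc invCount_rc contains_rc
  refine ⟨h1, ?_, h2⟩
  rw [gt_iff_lt, h2, avoidProb_eq, avoidProb_eq]
  have hZ : 0 < mallowsZ n q := Finset.sum_pos (fun σ _ => pow_pos hq.1 _) Finset.univ_nonempty
  refine div_lt_div_of_pos_right ?_ hZ
  exact (sum132_le n q hq.1).trans_lt ((trees_lt n hn q hq).trans_le (sum231_ge n q hq.1))
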